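/- Let x : M → ℝ be an assignment of values to the cells of a finite index set M, let j ∈ M, and let (S_i)_{i ∈ I} be a nonempty finite family of nonempty finite subsets of M each containing j. For each i define o_i = (1/|S_i|) Σ_{k ∈ S_i} x_k, V_i = (1/|S_i|) Σ_{k ∈ S_i} (x_k − o_i)², and ν_i = √(|S_i|·V_i). Then for every real number x̂ satisfying max_{i ∈ I}(o_i − ν_i) ≤ x̂ ≤ min_{i ∈ I}(o_i + ν_i), one has |x_j − x̂| ≤ min_{i ∈ I}(ν_i + o_i) + min_{i ∈ I}(ν_i − o_i). -/

import Mathlib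

/-- The deviation of one term from `c` is at most the root of the sum of squared deviations. -/
theorem abs_sub_le_sqrt_sum_sq {ι : Type*} {S : Finset ι} (x : ι → ℝ) (c : ℝ) {j : ι}
    (hj : j ∈ S) : |x j - c| ≤ Real.sqrt (∑ k ∈ S, (x k - c) ^ 2) :=
  Real.abs_le_sqrt <|
    Finset.single_le_sum (f := fun k => (x k - c) ^ 2) (fun _ _ => sq_nonneg _) hj

/-- Proposition 1 of the paper: for any valid estimate `xhat` of the cell value `x j`
(one lying in the interval determined by all transmitted means and variances of the
compressed cells containing `j`), the estimation error is bounded by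
`min_i (ν i + o i) + min_i (ν i - o i)`. -/
theorem compression_uncertainty_bound
    {ι κ : Type*} [DecidableEq ι] (M : Finset ι) (x : ι → ℝ) (j : ι) (hjM : j ∈ M)
    (I : Finset κ) (hI : I.Nonempty) (S : κ → Finset ι)
    (hSM : ∀ i ∈ I, S i ⊆ M) (hSne : ∀ i ∈ I, (S i).Nonempty)
    (hjS : ∀ i ∈ I, j ∈ S i)
    (o V ν : κ → ℝ)
    (ho : ∀ i ∈ I, o i = (1 / ((S i).card : ℝ)) * ∑ k ∈ S i, x k)
    (hV : ∀ i ∈ I, V i = (1 / ((S i).card : ℝ)) * ∑ k ∈ S i, (x k - o i) ^ 2)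
    (hν : ∀ i ∈ I, ν i = Real.sqrt (((S i).card : ℝ) * V i))
    (xhat : ℝ)
    (hlo : I.sup' hI (fun i => o i - ν i) ≤ xhat)
    (hhi : xhat ≤ I.inf' hI (fun i => o i + ν i)) :
    |x j - xhat| ≤ I.inf' hI (fun i => ν i + o i) + I.inf' hI (fun i => ν i - o i) := by
  have hdev : ∀ i ∈ I, |x j - o i| ≤ ν i := by
    intro i hi
    have hcard : ((S i).card : ℝ) ≠ 0 :=
      Nat.cast_ne_zero.mpr (Finset.card_ne_zero.mpr (hSne i hi))
    rw [hν i hi, hV i hi, ← mul_assoc, mul_one_div_cancel hcard, one_mul]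
    exact abs_sub_le_sqrt_sum_sq x (o i) (hjS i hi)
  obtain ⟨a, ha, hinf_a⟩ := Finset.exists_mem_eq_inf' hI (fun i => ν i + o i)
  obtain ⟨b, hb, hinf_b⟩ := Finset.exists_mem_eq_inf' hI (fun i => ν i - o i)
  rw [hinf_a, hinf_b]
  have hxa := abs_le.mp (hdev a ha)
  have hxb := abs_le.mp (hdev b hb)
  have hlo_b := (Finset.sup'_le_iff hI _).mp hlo b hb
  have hhi_a := (Finset.le_inf'_iff hI _).mp hhi a ha
  rw [abs_le]
  constructor <;> linarith [hxa.2, hxb.1]
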